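/- Let Γ be the set of complete Llull matrices on a finite set A of N elements, viewed as a subspace of the product space [0,1]^Π where Π is the set of ordered pairs of distinct elements of A. Then the map v ↦ v^π assigning to each complete Llull matrix its projected scores, and the map v ↦ (R_x)_{x ∈ A} assigning its rank-like rates, are continuous on Γ. -/

import Mathlib

/-! Common definitions: valued relations, indirect scores, admissible orders,
projected margins/scores, rank-like rates (Camps–Mora–Saumell CLC method). -/

variable {A : Type*} [Fintype A] [DecidableEq A]

/-- The score of a chain `x₀ :: x₁ :: ... :: xₙ`: the minimum of `v xᵢ xᵢ₊₁`
over its links (value `1` for chains with no link, which we never use). -/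
noncomputable def linkScore (v : A → A → ℝ) : List A → ℝ
  | [] => 1
  | [_] => 1
  | [a, b] => v a b
  | a :: b :: c :: l => min (v a b) (linkScore v (b :: c :: l))

/-- The indirect score `v*_{xy}`: the supremum (= maximum) of the scores of all
paths from `x` to `y` (with at least one link, consecutive elements distinct). -/
noncomputable def istar (v : A → A → ℝ) (x y : A) : ℝ :=
  sSup { s : ℝ | ∃ l : List A, List.Chain' (· ≠ ·) (x :: (l ++ [y])) ∧
      s = linkScore v (x :: (l ++ [y])) }

/-- `ξ` is a strict total order: irreflexive, transitive, total. -/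
def StrictTotal (ξ : A → A → Prop) : Prop :=
  (∀ x, ¬ ξ x x) ∧ (∀ x y z, ξ x y → ξ y z → ξ x z) ∧ (∀ x y, x ≠ y → ξ x y ∨ ξ y x)

/-- `ξ` is admissible for `v`: `v*_{xy} > v*_{yx}` implies `x` precedes `y`. -/
def Adm (v : A → A → ℝ) (ξ : A → A → Prop) : Prop :=
  ∀ x y, istar v x y > istar v y x → ξ x y

/-- Intermediate projected margin `m^σ_{xy}` (for `x` preceding `y` in `ξ`):
the infimum (= minimum) of the indirect margins `m*_{pq}` over `p ⪯ x`, `y ⪯ q`. -/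
noncomputable def msigma (v : A → A → ℝ) (ξ : A → A → Prop) (x y : A) : ℝ :=
  sInf { s : ℝ | ∃ p q, (ξ p x ∨ p = x) ∧ (ξ y q ∨ q = y) ∧
      s = istar v p q - istar v q p }

/-- `q` is the immediate successor of `p` in `ξ`. -/
def ImmSucc (ξ : A → A → Prop) (p q : A) : Prop :=
  ξ p q ∧ ∀ z, ¬ (ξ p z ∧ ξ z q)

/-- Projected margin (for `x` preceding `y` in `ξ`): the supremum (= maximum) of
`m^σ_{p p'}` over `x ⪯ p ≺ y`, `p'` the immediate successor of `p`. -/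
noncomputable def mpiAux (v : A → A → ℝ) (ξ : A → A → Prop) (x y : A) : ℝ :=
  sSup { s : ℝ | ∃ p q, (ξ x p ∨ p = x) ∧ ξ p y ∧ ImmSucc ξ p q ∧
      s = msigma v ξ p q }

open Classical in
/-- Projected margins `m^π`, extended antisymmetrically. -/
noncomputable def mpi (v : A → A → ℝ) (ξ : A → A → Prop) (x y : A) : ℝ :=
  if ξ x y then mpiAux v ξ x y else - mpiAux v ξ y x

/-- Projected scores `v^π_{xy} = (1 + m^π_{xy})/2`. -/
noncomputable def vpi (v : A → A → ℝ) (ξ : A → A → Prop) (x y : A) : ℝ :=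
  (1 + mpi v ξ x y) / 2

/-- Rank-like rate `R_x = N - ∑_{y ≠ x} v^π_{xy}`. -/
noncomputable def rlr (v : A → A → ℝ) (ξ : A → A → Prop) (x : A) : ℝ :=
  (Fintype.card A : ℝ) - ∑ y ∈ Finset.univ.erase x, vpi v ξ x y

/-- `v` is a complete Llull matrix: scores of distinct pairs lie in `[0,1]`
and satisfy `v_{xy} + v_{yx} = 1`. -/
def Llull (v : A → A → ℝ) : Prop :=
  ∀ x y : A, x ≠ y → 0 ≤ v x y ∧ v x y ≤ 1 ∧ v x y + v y x = 1

theorem linkScore_le_add_dist {A : Type*} [Fintype A] (v w : A → A → ℝ) :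
    ∀ l : List A, linkScore v l ≤ linkScore w l + dist v w
  | [] => by simp [linkScore]
  | [_] => by simp [linkScore]
  | [a, b] => by
    have h := (dist_le_pi_dist (v a) (w a) b).trans (dist_le_pi_dist v w a)
    rw [Real.dist_eq] at h
    simp only [linkScore]
    linarith [le_abs_self (v a b - w a b)]
  | a :: b :: c :: l => by
    have h := (dist_le_pi_dist (v a) (w a) b).trans (dist_le_pi_dist v w a)
    rw [Real.dist_eq] at h
    have ih := linkScore_le_add_dist v w (b :: c :: l)
    simp only [linkScore]
    rw [min_add]
    exact min_le_min (by linarith [le_abs_self (v a b - w a b)]) ih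

theorem linkScore_zero_le {A : Type*} : ∀ l : List A, linkScore (fun _ _ : A => (0 : ℝ)) l ≤ 1
  | [] => by simp [linkScore]
  | [_] => by simp [linkScore]
  | [_, _] => by simp [linkScore]
  | _ :: b :: c :: l => (min_le_right _ _).trans (linkScore_zero_le (b :: c :: l))

theorem continuous_istar {A : Type*} [Fintype A] (x y : A) :
    Continuous fun v : A → A → ℝ => istar v x y := by
  refine (LipschitzWith.of_le_add fun v w => ?_).continuous
  unfold istar
  rcases Set.eq_empty_or_nonempty
    {s : ℝ | ∃ l : List A, List.Chain' (· ≠ ·) (x :: (l ++ [y])) ∧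
      s = linkScore v (x :: (l ++ [y]))} with h | h
  · have hw : {s : ℝ | ∃ l : List A, List.Chain' (· ≠ ·) (x :: (l ++ [y])) ∧
        s = linkScore w (x :: (l ++ [y]))} = ∅ := by
      refine Set.eq_empty_of_forall_notMem ?_
      rintro _ ⟨l, hl, -⟩
      exact Set.eq_empty_iff_forall_notMem.1 h _ ⟨l, hl, rfl⟩
    rw [h, hw]
    simp
  · refine csSup_le h ?_
    rintro _ ⟨l, hl, rfl⟩
    refine (linkScore_le_add_dist v w _).trans ?_
    gcongr
    refine le_csSup ⟨1 + dist w fun _ _ => 0, ?_⟩ ⟨l, hl, rfl⟩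
    rintro _ ⟨l', -, rfl⟩
    refine (linkScore_le_add_dist w (fun _ _ => 0) _).trans ?_
    gcongr
    exact linkScore_zero_le _

/-- The nonempty type of sets separating `x` from `y`. -/
abbrev Cut {A : Type*} (x y : A) : Type _ := {I : Finset A // x ∈ I ∧ y ∉ I}

theorem Cut.univ_nonempty {A : Type*} [Fintype A] [DecidableEq A] {x y : A} (h : x ≠ y) :
    (Finset.univ : Finset (Cut x y)).Nonempty :=
  ⟨⟨{x}, by simpa using h.symm⟩, Finset.mem_univ _⟩

theorem Cut.product_nonempty {A : Type*} [Fintype A] [DecidableEq A] {x y : A} (I : Cut x y) :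
    (I.1 ×ˢ I.1ᶜ).Nonempty :=
  ⟨(x, y), by simpa using I.2⟩

/-- The smallest indirect margin across a cut. -/
noncomputable def cutMargin {A : Type*} [Fintype A] [DecidableEq A] (v : A → A → ℝ) {x y : A}
    (I : Cut x y) : ℝ :=
  (I.1 ×ˢ I.1ᶜ).inf' I.product_nonempty fun p => istar v p.1 p.2 - istar v p.2 p.1

/-- The largest nonnegative margin over the cuts separating `x` from `y`. -/
noncomputable def maxCutMargin {A : Type*} [Fintype A] [DecidableEq A] (v : A → A → ℝ) {x y : A}
    (h : x ≠ y) : ℝ :=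
  Finset.univ.sup' (Cut.univ_nonempty h) fun I => max 0 (cutMargin v I)

theorem continuous_maxCutMargin {A : Type*} [Fintype A] [DecidableEq A] {x y : A} (h : x ≠ y) :
    Continuous fun v : A → A → ℝ => maxCutMargin v h :=
  Continuous.finset_sup'_apply _ fun _ _ => continuous_const.max <|
    Continuous.finset_inf'_apply _ fun p _ =>
      (continuous_istar p.1 p.2).sub (continuous_istar p.2 p.1)

theorem cutMargin_le {A : Type*} [Fintype A] [DecidableEq A] (v : A → A → ℝ) {x y : A}
    (I : Cut x y) {a b : A} (ha : a ∈ I.1) (hb : b ∉ I.1) :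
    cutMargin v I ≤ istar v a b - istar v b a :=
  Finset.inf'_le (fun p : A × A => istar v p.1 p.2 - istar v p.2 p.1)
    (b := (a, b)) (by simp [ha, hb])

theorem le_cutMargin {A : Type*} [Fintype A] [DecidableEq A] {v : A → A → ℝ} {x y : A}
    {I : Cut x y} {c : ℝ} (h : ∀ a ∈ I.1, ∀ b ∉ I.1, c ≤ istar v a b - istar v b a) :
    c ≤ cutMargin v I := by
  refine Finset.le_inf' _ _ fun p hp => ?_
  rw [Finset.mem_product, Finset.mem_compl] at hp
  exact h _ hp.1 _ hp.2

theorem msigma_eq_cutMargin {A : Type*} [Fintype A] [DecidableEq A] (v : A → A → ℝ)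
    {ξ : A → A → Prop} {x y p q : A} (I : Cut x y) (hp : ∀ a, a ∈ I.1 ↔ ξ a p ∨ a = p)
    (hq : ∀ b, b ∉ I.1 ↔ ξ q b ∨ b = q) : msigma v ξ p q = cutMargin v I := by
  refine IsGLB.csInf_eq ⟨?_, fun c hc => ?_⟩ ⟨_, p, q, Or.inr rfl, Or.inr rfl, rfl⟩
  · rintro _ ⟨a, b, ha, hb, rfl⟩
    exact cutMargin_le v I ((hp a).2 ha) ((hq b).2 hb)
  · exact le_cutMargin fun a ha b hb => hc ⟨a, b, (hp a).1 ha, (hq b).1 hb, rfl⟩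

theorem StrictTotal.exists_immSucc {A : Type*} [Fintype A] {ξ : A → A → Prop}
    (hξ : StrictTotal ξ) {x y : A} (I : Cut x y) (hI : ∀ a ∈ I.1, ∀ b ∉ I.1, ξ a b) :
    ∃ p q, ImmSucc ξ p q ∧ (∀ a, a ∈ I.1 ↔ ξ a p ∨ a = p) ∧
      ∀ b, b ∉ I.1 ↔ ξ q b ∨ b = q := by
  obtain ⟨hirr, htr, htot⟩ := hξ
  have : Std.Irrefl ξ := ⟨hirr⟩
  have : IsTrans A ξ := ⟨htr⟩
  have : Std.Irrefl (flip ξ) := ⟨hirr⟩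
  have : IsTrans A (flip ξ) := ⟨fun a b c h₁ h₂ => htr c b a h₂ h₁⟩
  obtain ⟨p, hp, hp'⟩ := (Finite.wellFounded_of_trans_of_irrefl (flip ξ)).has_min
    {a | a ∈ I.1} ⟨x, I.2.1⟩
  obtain ⟨q, hq, hq'⟩ := (Finite.wellFounded_of_trans_of_irrefl ξ).has_min
    {b | b ∉ I.1} ⟨y, I.2.2⟩
  simp only [Set.mem_ofPred_eq, flip] at hp hp' hq hq'
  refine ⟨p, q, ⟨hI p hp q hq, fun z hz => ?_⟩, fun a => ⟨fun ha => ?_, fun ha => ?_⟩,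
    fun b => ⟨fun hb => ?_, fun hb => ?_⟩⟩
  · by_cases h : z ∈ I.1
    · exact hp' z h hz.1
    · exact hq' z h hz.2
  · by_cases h : a = p
    · exact Or.inr h
    · exact Or.inl ((htot a p h).resolve_right (hp' a ha))
  · by_contra h
    rcases ha with ha | rfl
    · exact hirr _ (htr _ _ _ ha (hI p hp a h))
    · exact h hp
  · by_cases h : b = q
    · exact Or.inr h
    · exact Or.inl ((htot b q h).resolve_left (hq' b hb))
  · intro h
    rcases hb with hb | rfl
    · exact hirr _ (htr _ _ _ hb (hI b h q hq))
    · exact hq h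

theorem Adm.istar_le {A : Type*} {v : A → A → ℝ} {ξ : A → A → Prop}
    (hξ : StrictTotal ξ) (hv : Adm v ξ) {x y : A} (h : ξ x y) : istar v y x ≤ istar v x y := by
  by_contra! hlt
  exact hξ.1 _ (hξ.2.1 _ _ _ h (hv y x hlt))

theorem mpiAux_eq_maxCutMargin {A : Type*} [Fintype A] [DecidableEq A] {v : A → A → ℝ}
    {ξ : A → A → Prop} (hξ : StrictTotal ξ) (hv : Adm v ξ) {x y : A} (hne : x ≠ y)
    (hxy : ξ x y) : mpiAux v ξ x y = maxCutMargin v hne := by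
  classical
  have hmem : ∀ I : Cut x y, (∀ a ∈ I.1, ∀ b ∉ I.1, ξ a b) →
      ∃ p q, (ξ x p ∨ p = x) ∧ ξ p y ∧ ImmSucc ξ p q ∧ cutMargin v I = msigma v ξ p q := by
    intro I hI
    obtain ⟨p, q, hpq, hp, hq⟩ := hξ.exists_immSucc I hI
    exact ⟨p, q, ((hp x).1 I.2.1).imp id Eq.symm,
      hI p ((hp p).2 (Or.inr rfl)) y I.2.2, hpq, (msigma_eq_cutMargin v I hp hq).symm⟩
  have hle : maxCutMargin v hne ∈ upperBounds {s : ℝ | ∃ p q, (ξ x p ∨ p = x) ∧ ξ p y ∧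
      ImmSucc ξ p q ∧ s = msigma v ξ p q} := by
    rintro _ ⟨p, q, hxp, hpy, hpq, rfl⟩
    obtain ⟨hirr, htr, htot⟩ := hξ
    let I : Cut x y := ⟨Finset.univ.filter fun a => ξ a p ∨ a = p, by
      simp only [Finset.mem_filter, Finset.mem_univ, true_and]
      refine ⟨hxp.imp id Eq.symm, ?_⟩
      rintro (h | rfl)
      · exact hirr _ (htr _ _ _ h hpy)
      · exact hirr _ hpy⟩
    have hp : ∀ a, a ∈ I.1 ↔ ξ a p ∨ a = p := by simp [I]
    have hq : ∀ b, b ∉ I.1 ↔ ξ q b ∨ b = q := by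
      intro b
      rw [hp]
      constructor
      · intro hb
        push Not at hb
        by_cases h : b = q
        · exact Or.inr h
        · exact Or.inl ((htot b q h).resolve_left fun hbq =>
            hpq.2 b ⟨(htot b p hb.2).resolve_left hb.1, hbq⟩)
      · intro hb h
        have hpb : ξ p b := by
          rcases hb with hb | rfl
          · exact htr _ _ _ hpq.1 hb
          · exact hpq.1
        rcases h with h | rfl
        · exact hirr _ (htr _ _ _ h hpb)
        · exact hirr _ hpb
    rw [msigma_eq_cutMargin v I hp hq]
    exact (le_max_right 0 _).trans
      (Finset.le_sup' (fun I => max 0 (cutMargin v I)) (Finset.mem_univ I))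
  let J : Cut x y := ⟨Finset.univ.filter fun a => ξ a x ∨ a = x, by
    simp only [Finset.mem_filter, Finset.mem_univ, true_and, or_true]
    rintro (h | h)
    · exact hξ.1 _ (hξ.2.1 _ _ _ h hxy)
    · exact hne h.symm⟩
  have hJ : ∀ a ∈ J.1, ∀ b ∉ J.1, ξ a b := by
    intro a ha b hb
    simp only [J, Finset.mem_filter, Finset.mem_univ, true_and] at ha hb
    push Not at hb
    have hxb : ξ x b := (hξ.2.2 b x hb.2).resolve_left hb.1
    rcases ha with ha | rfl
    · exact hξ.2.1 _ _ _ ha hxb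
    · exact hxb
  refine le_antisymm (csSup_le ⟨_, hmem J hJ⟩ hle) (Finset.sup'_le _ _ fun I _ => ?_)
  rcases le_or_gt (cutMargin v I) 0 with h | h
  · rw [max_eq_left h]
    exact (le_cutMargin fun a ha b hb => sub_nonneg.2 (hv.istar_le hξ (hJ a ha b hb))).trans
      (le_csSup ⟨_, hle⟩ (hmem J hJ))
  · rw [max_eq_right h.le]
    refine le_csSup ⟨_, hle⟩ (hmem I fun a ha b hb => hv a b ?_)
    linarith [cutMargin_le v I ha hb]

theorem maxCutMargin_eq_zero {A : Type*} [Fintype A] [DecidableEq A] {v : A → A → ℝ} {x y : A}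
    (hne : x ≠ y) (h : istar v x y ≤ istar v y x) : maxCutMargin v hne = 0 := by
  have hI : ∀ I : Cut x y, max 0 (cutMargin v I) = 0 := fun I =>
    max_eq_left ((cutMargin_le v I I.2.1 I.2.2).trans (sub_nonpos.2 h))
  simp [maxCutMargin, hI]

/-- Projected scores in terms of cuts, with no reference to an admissible order. -/
theorem vpi_eq_maxCutMargin {A : Type*} [Fintype A] [DecidableEq A] {v : A → A → ℝ}
    {ξ : A → A → Prop} (hξ : StrictTotal ξ) (hv : Adm v ξ) {x y : A} (hne : x ≠ y) :
    vpi v ξ x y = (1 + (maxCutMargin v hne - maxCutMargin v hne.symm)) / 2 := by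
  unfold vpi mpi
  rcases hξ.2.2 x y hne with h | h
  · rw [if_pos h, mpiAux_eq_maxCutMargin hξ hv hne h,
      maxCutMargin_eq_zero hne.symm (hv.istar_le hξ h), sub_zero]
  · rw [if_neg fun h' => hξ.1 _ (hξ.2.1 _ _ _ h h'), mpiAux_eq_maxCutMargin hξ hv hne.symm h,
      maxCutMargin_eq_zero hne (hv.istar_le hξ h), zero_sub]

/-- The maps `v ↦ v^π` (projected scores) and `v ↦ (R_x)_{x∈A}`
(rank-like rates) are continuous on the set `Γ` of complete Llull matrices,
viewed inside the product space. Stated for any selection `F` of the projected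
scores (which are independent of the admissible order used). -/
theorem stmt12 {A : Type*} [Fintype A] [DecidableEq A]
    (F : (A → A → ℝ) → (A → A → ℝ))
    (hF : ∀ v : A → A → ℝ, Llull v → ∃ ξ : A → A → Prop,
      StrictTotal ξ ∧ Adm v ξ ∧ ∀ x y : A, x ≠ y → F v x y = vpi v ξ x y) :
    (∀ x y : A, x ≠ y →
      ContinuousOn (fun v : A → A → ℝ => F v x y) {v : A → A → ℝ | Llull v}) ∧
    (∀ x : A,
      ContinuousOn
        (fun v : A → A → ℝ =>
          (Fintype.card A : ℝ) - ∑ y ∈ Finset.univ.erase x, F v x y)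
        {v : A → A → ℝ | Llull v}) := by
  have hcont : ∀ x y : A, x ≠ y →
      ContinuousOn (fun v : A → A → ℝ => F v x y) {v : A → A → ℝ | Llull v} := by
    intro x y hne
    refine ContinuousOn.congr (f := fun v : A → A → ℝ =>
      (1 + (maxCutMargin v hne - maxCutMargin v hne.symm)) / 2) ?_ fun v hv => ?_
    · exact ((continuous_const.add ((continuous_maxCutMargin hne).sub
        (continuous_maxCutMargin hne.symm))).div_const 2).continuousOn
    · obtain ⟨ξ, hξ, hadm, h⟩ := hF v hv
      exact (h x y hne).trans (vpi_eq_maxCutMargin hξ hadm hne)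
  refine ⟨hcont, fun x => continuousOn_const.sub (continuousOn_finsetSum _ fun y hy => ?_)⟩
  exact hcont x y (Finset.ne_of_mem_erase hy).symm
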